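/- For every n ≥ 1 and every finite monoid M: M belongs to V_n if and only if M satisfies the identity u_n = v_n and the identity x·x^ω = x^ω for all x ∈ M. -/

import Mathlib

/-- The ω-power of an element of a finite monoid: `m ^ (card M)!`, which is
the unique idempotent among the positive powers of `m`. -/
def omegaPow {M : Type} [Monoid M] [Fintype M] (m : M) : M :=
  m ^ (Fintype.card M).factorial

/-- A monoid is `J`-trivial if equality of the two-sided ideals generated by
two elements implies equality of the elements. -/
def JTrivial (M : Type) [Monoid M] : Prop :=
  ∀ s t : M, {x : M | ∃ a b : M, a * s * b = x} = {x : M | ∃ a b : M, a * t * b = x} → s = t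

/-- A bundled finite monoid. -/
structure BFinMonoid : Type 1 where
  carrier : Type
  [mon : Monoid carrier]
  [fin : Fintype carrier]

attribute [instance] BFinMonoid.mon BFinMonoid.fin

/-- Auxiliary function for the transduction `τ_ψ`, accumulating the image of the
prefix read so far. -/
def tauAux {A N : Type} [Monoid N] (ψ : FreeMonoid A →* N) : N → List A → List (N × A × N)
  | _, [] => []
  | p, a :: rest =>
    (p, a, ψ (FreeMonoid.ofList rest)) :: tauAux ψ (p * ψ (FreeMonoid.of a)) rest

/-- The transduction `τ_ψ : A* → (N × A × N)*` sending `a₁ ⋯ aₙ` to `σ₁ ⋯ σₙ` where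
`σᵢ = (ψ(a₁ ⋯ a_{i-1}), aᵢ, ψ(a_{i+1} ⋯ aₙ))`. -/
def tau {A N : Type} [Monoid N] (ψ : FreeMonoid A →* N) (w : FreeMonoid A) :
    FreeMonoid (N × A × N) :=
  FreeMonoid.ofList (tauAux ψ 1 (FreeMonoid.toList w))

/-- Membership of a finite monoid `M` in `P ** J`, where `P` is a class of finite
monoids: there are a finite alphabet `A`, a surjective homomorphism `φ : A* → M`,
a homomorphism `ψ : A* → N` into a finite `J`-trivial monoid `N` and a homomorphism
`h : (N × A × N)* → K` into a finite monoid `K` with `P K`, such that `ψ v = ψ w`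
and `h (τ_ψ v) = h (τ_ψ w)` together imply `φ v = φ w`. -/
def MemBlockJ (P : BFinMonoid → Prop) (M : BFinMonoid) : Prop :=
  ∃ (A : Type) (_ : Fintype A) (φ : FreeMonoid A →* M.carrier), Function.Surjective φ ∧
    ∃ (N : BFinMonoid) (ψ : FreeMonoid A →* N.carrier), JTrivial N.carrier ∧
      ∃ (K : BFinMonoid) (h : FreeMonoid (N.carrier × A × N.carrier) →* K.carrier),
        P K ∧ ∀ v w : FreeMonoid A, ψ v = ψ w → h (tau ψ v) = h (tau ψ w) → φ v = φ w

/-- The sequence of pseudovarieties `V₁ = J`, `V_{n+1} = V_n ** J`, as membership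
predicates on bundled finite monoids (the value at `0` is unused). -/
def VMem : ℕ → BFinMonoid → Prop
  | 0, _ => True
  | 1, M => JTrivial M.carrier
  | n + 2, M => MemBlockJ (VMem (n + 1)) M

/-- `chainProd X k = X 1 * X 2 * ⋯ * X k`. -/
def chainProd {M : Type} [Monoid M] (X : ℕ → M) (k : ℕ) : M :=
  ((List.range k).map fun i => X (i + 1)).prod

/-- The value of the term `u_n` under the assignment `X` of the variables `x₁, x₂, …`:
`u₁ = (x₁x₂)^ω` and `u_{n+1} = (x₁⋯x_{2n}x_{2n+1})^ω · u_n · (x_{2n+2}x₁⋯x_{2n})^ω`. -/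
def uTerm {M : Type} [Monoid M] [Fintype M] (X : ℕ → M) : ℕ → M
  | 0 => 1
  | 1 => omegaPow (X 1 * X 2)
  | n + 2 => omegaPow (chainProd X (2 * (n + 1) + 1)) * uTerm X (n + 1) *
      omegaPow (X (2 * (n + 1) + 2) * chainProd X (2 * (n + 1)))

/-- The value of the term `v_n` under the assignment `X`:
`v₁ = (x₂x₁)^ω` and `v_{n+1} = (x₁⋯x_{2n}x_{2n+1})^ω · v_n · (x_{2n+2}x₁⋯x_{2n})^ω`. -/
def vTerm {M : Type} [Monoid M] [Fintype M] (X : ℕ → M) : ℕ → M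
  | 0 => 1
  | 1 => omegaPow (X 2 * X 1)
  | n + 2 => omegaPow (chainProd X (2 * (n + 1) + 1)) * vTerm X (n + 1) *
      omegaPow (X (2 * (n + 1) + 2) * chainProd X (2 * (n + 1)))

section Terms

variable {M L : Type} [Monoid M] [Monoid L]

/-- The common shape of the terms `u_{n+1}` and `v_{n+1}`: the innermost term `b` is wrapped `n`
times, with the exponent `e` in place of `ω`. -/
def wrap (e : ℕ) (X : ℕ → M) (b : M) : ℕ → M
  | 0 => b
  | n + 1 => chainProd X (2 * (n + 1) + 1) ^ e * wrap e X b n *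
      (X (2 * (n + 1) + 2) * chainProd X (2 * (n + 1))) ^ e

/-- `M` satisfies `x ^ (e + 1) = x ^ e` and `u_{n+1} = v_{n+1}`, with `e` in place of `ω`. -/
structure SatE (e n : ℕ) (M : Type) [Monoid M] : Prop where
  pow_succ_eq : ∀ x : M, x ^ (e + 1) = x ^ e
  wrap_eq : ∀ X : ℕ → M, wrap e X ((X 1 * X 2) ^ e) n = wrap e X ((X 2 * X 1) ^ e) n

theorem chainProd_succ (X : ℕ → M) (k : ℕ) : chainProd X (k + 1) = chainProd X k * X (k + 1) := by
  simp [chainProd, List.range_succ]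

theorem map_chainProd (f : M →* L) (X : ℕ → M) (k : ℕ) :
    f (chainProd X k) = chainProd (fun i => f (X i)) k := by
  simp [chainProd, map_list_prod, Function.comp_def]

theorem map_wrap (f : M →* L) (e : ℕ) (X : ℕ → M) (b : M) (n : ℕ) :
    f (wrap e X b n) = wrap e (fun i => f (X i)) (f b) n := by
  induction n with
  | zero => rfl
  | succ n ih => simp [wrap, ih, map_chainProd]

theorem chainProd_congr {X Y : ℕ → M} {k : ℕ} (h : ∀ i, 1 ≤ i → i ≤ k → X i = Y i) :
    chainProd X k = chainProd Y k := by
  unfold chainProd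
  congr 1
  refine List.map_congr_left fun i hi => h _ (by omega) ?_
  have := List.mem_range.1 hi
  omega

theorem wrap_congr {e : ℕ} {X Y : ℕ → M} {b : M} {n : ℕ}
    (h : ∀ i, 1 ≤ i → i ≤ 2 * n + 2 → X i = Y i) : wrap e X b n = wrap e Y b n := by
  induction n with
  | zero => rfl
  | succ n ih =>
    simp only [wrap]
    rw [ih fun i h1 h2 => h i h1 (by omega), h _ (by omega) (by omega),
      chainProd_congr (k := 2 * (n + 1) + 1) fun i h1 h2 => h i h1 (by omega),
      chainProd_congr (k := 2 * (n + 1)) fun i h1 h2 => h i h1 (by omega)]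

theorem chainProd_mem (S : Submonoid M) {X : ℕ → M} {k : ℕ}
    (h : ∀ i, 1 ≤ i → i ≤ k → X i ∈ S) : chainProd X k ∈ S := by
  refine S.list_prod_mem fun x hx => ?_
  obtain ⟨i, hi, rfl⟩ := List.mem_map.1 hx
  have := List.mem_range.1 hi
  exact h _ (by omega) (by omega)

theorem wrap_mem (S : Submonoid M) {e : ℕ} {X : ℕ → M} {b : M} {n : ℕ} (hb : b ∈ S)
    (h : ∀ i, 1 ≤ i → i ≤ 2 * n + 2 → X i ∈ S) : wrap e X b n ∈ S := by
  induction n with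
  | zero => exact hb
  | succ n ih =>
    refine S.mul_mem (S.mul_mem (S.pow_mem ?_ _) (ih fun i h1 h2 => h i h1 (by omega)))
      (S.pow_mem (S.mul_mem (h _ (by omega) (by omega)) ?_) _)
    · exact chainProd_mem S fun i h1 h2 => h i h1 (by omega)
    · exact chainProd_mem S fun i h1 h2 => h i h1 (by omega)

theorem pow_eq_of_le {e f : ℕ} {x : M} (h : x ^ (e + 1) = x ^ e) (hf : e ≤ f) :
    x ^ f = x ^ e := by
  induction f, hf using Nat.le_induction with
  | base => rfl
  | succ f _ ih => rw [pow_succ, ih, ← pow_succ, h]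

theorem wrap_eq_of_le {e f : ℕ} (h : ∀ x : M, x ^ (e + 1) = x ^ e) (hf : e ≤ f)
    (X : ℕ → M) (b : M) (n : ℕ) : wrap f X b n = wrap e X b n := by
  induction n with
  | zero => rfl
  | succ n ih => simp only [wrap, ih, pow_eq_of_le (h _) hf]

theorem SatE.mono {e f n : ℕ} (h : SatE e n M) (hf : e ≤ f) : SatE f n M where
  pow_succ_eq x := by
    rw [pow_eq_of_le (h.1 x) hf, pow_eq_of_le (h.1 x) (hf.trans f.le_succ)]
  wrap_eq X := by
    simp only [wrap_eq_of_le h.1 hf, pow_eq_of_le (h.1 _) hf, h.2]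

theorem SatE.of_zero {e : ℕ} (h : SatE e 0 M) (n : ℕ) : SatE e n M where
  pow_succ_eq := h.1
  wrap_eq X := by
    have := h.2 X
    simp only [wrap] at this
    rw [this]

theorem SatE.of_jointly_injective {ι : Type} {R : ι → Type} [∀ i, Monoid (R i)]
    (f : ∀ i, M →* R i) (hf : ∀ x y, (∀ i, f i x = f i y) → x = y) {e n : ℕ}
    (h : ∀ i, SatE e n (R i)) : SatE e n M where
  pow_succ_eq x := hf _ _ fun i => by simpa using (h i).1 (f i x)
  wrap_eq X := hf _ _ fun i => by simpa [map_wrap] using (h i).2 fun j => f i (X j)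

theorem SatE.pi {ι : Type} {R : ι → Type} [∀ i, Monoid (R i)] {e n : ℕ}
    (h : ∀ i, SatE e n (R i)) : SatE e n (∀ i, R i) :=
  .of_jointly_injective (fun i => Pi.evalMonoidHom R i) (fun _ _ => funext) h

theorem SatE.prod {e n : ℕ} (hM : SatE e n M) (hL : SatE e n L) : SatE e n (M × L) where
  pow_succ_eq x := Prod.ext (hM.1 x.1) (hL.1 x.2)
  wrap_eq X := by
    refine Prod.ext ?_ ?_
    · change MonoidHom.fst M L _ = MonoidHom.fst M L _
      simpa only [map_wrap, map_pow, map_mul] using hM.2 fun i => MonoidHom.fst M L (X i)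
    · change MonoidHom.snd M L _ = MonoidHom.snd M L _
      simpa only [map_wrap, map_pow, map_mul] using hL.2 fun i => MonoidHom.snd M L (X i)

theorem uTerm_eq_wrap [Fintype M] (X : ℕ → M) (n : ℕ) :
    uTerm X (n + 1) = wrap (Fintype.card M).factorial X
      ((X 1 * X 2) ^ (Fintype.card M).factorial) n := by
  induction n with
  | zero => rfl
  | succ n ih => rw [wrap, uTerm, ih, omegaPow, omegaPow]

theorem vTerm_eq_wrap [Fintype M] (X : ℕ → M) (n : ℕ) :
    vTerm X (n + 1) = wrap (Fintype.card M).factorial X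
      ((X 2 * X 1) ^ (Fintype.card M).factorial) n := by
  induction n with
  | zero => rfl
  | succ n ih => rw [wrap, vTerm, ih, omegaPow, omegaPow]

theorem exists_pow_eq_pow [Fintype M] (x : M) :
    ∃ i d, i ≤ Fintype.card M ∧ x ^ i = x ^ (i + (d + 1)) := by
  obtain ⟨i, j, hij, h⟩ := Fintype.exists_ne_map_eq_of_card_lt
    (fun i : Fin (Fintype.card M + 1) => x ^ (i : ℕ)) (by simp)
  rcases lt_or_gt_of_ne hij with hlt | hlt
  · refine ⟨i, j - i - 1, by omega, ?_⟩
    rw [show (i : ℕ) + (j - i - 1 + 1) = j by have : (i : ℕ) < j := hlt; omega]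
    exact h
  · refine ⟨j, i - j - 1, by omega, ?_⟩
    rw [show (j : ℕ) + (i - j - 1 + 1) = i by have : (j : ℕ) < i := hlt; omega]
    exact h.symm

theorem pow_card_succ_eq [Fintype M] {e : ℕ} {x : M} (h : x ^ (e + 1) = x ^ e) :
    x ^ (Fintype.card M + 1) = x ^ Fintype.card M := by
  obtain ⟨i, d, hi, hx⟩ := exists_pow_eq_pow x
  have hk : ∀ k, x ^ i = x ^ (i + k * (d + 1)) := by
    intro k
    induction k with
    | zero => simp
    | succ k ih =>
      rw [show i + (k + 1) * (d + 1) = i + (d + 1) + k * (d + 1) by ring, pow_add, ← hx,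
        ← pow_add, ← ih]
  have hle : e ≤ i + e * (d + 1) := by nlinarith
  have hi' : x ^ (i + 1) = x ^ i := by
    have h2 : x ^ i = x ^ e := (hk e).trans (pow_eq_of_le h hle)
    rw [pow_succ, h2, ← pow_succ, h]
  rw [pow_eq_of_le hi' (by omega : i ≤ Fintype.card M + 1), pow_eq_of_le hi' hi]

theorem identities_iff_exists_satE [Fintype M] (n : ℕ) :
    ((∀ X : ℕ → M, uTerm X (n + 1) = vTerm X (n + 1)) ∧
      ∀ x : M, x * omegaPow x = omegaPow x) ↔ ∃ e, SatE e n M := by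
  simp only [uTerm_eq_wrap, vTerm_eq_wrap, omegaPow, ← pow_succ']
  refine ⟨fun h => ⟨_, h.2, h.1⟩, fun ⟨e, he⟩ => ?_⟩
  have h : ∀ x : M, x ^ ((Fintype.card M).factorial + 1) = x ^ (Fintype.card M).factorial := by
    intro x
    have := pow_card_succ_eq (he.1 x)
    have hc := Nat.self_le_factorial (Fintype.card M)
    rw [pow_eq_of_le this hc, pow_eq_of_le this (hc.trans (Nat.le_succ _))]
  refine ⟨fun X => ?_, h⟩
  have key := (he.mono (Nat.le_add_left e (Fintype.card M).factorial)).2 X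
  simpa only [wrap_eq_of_le h (Nat.le_add_right _ e), pow_eq_of_le (h _) (Nat.le_add_right _ e)]
    using key

end Terms

section JTrivial

variable {M : Type} [Monoid M]

theorem jTrivial_iff :
    JTrivial M ↔ ∀ s t a b c d : M, a * t * b = s → c * s * d = t → s = t := by
  refine ⟨fun h s t a b c d hs ht => h s t (Set.ext fun x => ⟨?_, ?_⟩), fun h s t hst => ?_⟩
  · rintro ⟨p, q, rfl⟩
    exact ⟨p * a, b * q, by rw [← hs]; simp only [mul_assoc]⟩
  · rintro ⟨p, q, rfl⟩
    exact ⟨p * c, d * q, by rw [← ht]; simp only [mul_assoc]⟩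
  · have hs : s ∈ {x : M | ∃ a b : M, a * t * b = x} := hst ▸ ⟨1, 1, by simp⟩
    have ht : t ∈ {x : M | ∃ a b : M, a * s * b = x} := hst ▸ ⟨1, 1, by simp⟩
    obtain ⟨a, b, hab⟩ := hs
    obtain ⟨c, d, hcd⟩ := ht
    exact h s t a b c d hab hcd

theorem JTrivial.mul_right_eq (h : JTrivial M) {m x y : M} (hm : m * x * y = m) : m * x = m :=
  jTrivial_iff.1 h _ _ 1 x 1 y (by simp) (by simpa using hm)

theorem JTrivial.mul_left_eq (h : JTrivial M) {m x y : M} (hm : y * (x * m) = m) : x * m = m :=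
  jTrivial_iff.1 h _ _ x 1 y 1 (by simp) (by simpa using hm)

theorem JTrivial.satE [Fintype M] (h : JTrivial M) : SatE (Fintype.card M) 0 M := by
  have hap : ∀ x : M, x ^ (Fintype.card M + 1) = x ^ Fintype.card M := by
    intro x
    obtain ⟨i, d, hi, hx⟩ := exists_pow_eq_pow x
    refine pow_card_succ_eq (e := i) ?_
    rw [pow_succ]
    refine h.mul_right_eq (y := x ^ d) ?_
    rw [mul_assoc, ← pow_succ', ← pow_add, ← hx]
  refine ⟨hap, fun X => ?_⟩
  have key : ∀ x y : M, x * (y * x) ^ Fintype.card M * y = (x * y) ^ Fintype.card M := by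
    intro x y
    rw [← hap (x * y), ← mul_pow_mul, mul_assoc, ← pow_succ]
  exact jTrivial_iff.1 h _ _ _ _ _ _ (key _ _) (key _ _)

theorem SatE.mul_pow_comm {e : ℕ} (h : SatE e 0 M) (x y : M) : (x * y) ^ e = (y * x) ^ e :=
  h.2 fun i => if i = 1 then x else y

theorem SatE.mul_pow_left {e : ℕ} (h : SatE e 0 M) (x y : M) :
    x * (x * y) ^ e = (x * y) ^ e := by
  have hc := h.mul_pow_comm x y
  have hstep : (x * y) ^ e = x * (x * y) ^ e * y := by
    conv_lhs => rw [← h.1, pow_succ, ← mul_assoc, mul_pow_mul, ← hc]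
  generalize (x * y) ^ e = E at hstep
  have hk : ∀ k, E = x ^ k * E * y ^ k := by
    intro k
    induction k with
    | zero => simp
    | succ k ih =>
      calc E = x ^ k * (x * E * y) * y ^ k := by rw [← hstep, ← ih]
        _ = x ^ (k + 1) * E * y ^ (k + 1) := by
          rw [pow_succ, pow_succ' y]; simp only [mul_assoc]
  rw [hk e, ← mul_assoc, ← mul_assoc, ← pow_succ', h.1]

theorem SatE.mul_pow_right {e : ℕ} (h : SatE e 0 M) (x y : M) :
    (x * y) ^ e * y = (x * y) ^ e := by
  rw [h.mul_pow_comm x y, mul_pow_mul, h.mul_pow_comm x y, h.mul_pow_left]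

theorem SatE.jTrivial {e : ℕ} (h : SatE e 0 M) : JTrivial M := by
  refine jTrivial_iff.2 fun s t a b c d hs ht => ?_
  have hk : ∀ k, s = (a * c) ^ k * s * (d * b) ^ k := by
    intro k
    induction k with
    | zero => simp
    | succ k ih =>
      calc s = (a * c) ^ k * (a * (c * s * d) * b) * (d * b) ^ k := by rw [ht, hs, ← ih]
        _ = _ := by rw [pow_succ, pow_succ' (d * b)]; simp only [mul_assoc]
  have hl : c * (a * c) ^ e = (a * c) ^ e := by rw [h.mul_pow_comm a c, h.mul_pow_left]
  have hr : (d * b) ^ e * d = (d * b) ^ e := by rw [h.mul_pow_comm d b, h.mul_pow_right]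
  calc s = (c * (a * c) ^ e) * s * ((d * b) ^ e * d) := by rw [hl, hr, ← hk]
    _ = c * ((a * c) ^ e * s * (d * b) ^ e) * d := by simp only [mul_assoc]
    _ = t := by rw [← hk, ht]

theorem jTrivial_iff_exists_satE [Finite M] : JTrivial M ↔ ∃ e, SatE e 0 M := by
  have := Fintype.ofFinite M
  exact ⟨fun h => ⟨_, h.satE⟩, fun ⟨_, h⟩ => h.jTrivial⟩

end JTrivial

section Transduction

variable {A N : Type} [Monoid N]

/-- The transduction of `tau` with explicit left context `p` and right context `q`. -/
def ctxWord (ψ : FreeMonoid A →* N) : N → List A → N → List (N × A × N)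
  | _, [], _ => []
  | p, a :: w, q => (p, a, ψ (FreeMonoid.ofList w) * q) :: ctxWord ψ (p * ψ (FreeMonoid.of a)) w q

theorem tauAux_eq_ctxWord (ψ : FreeMonoid A →* N) (w : List A) (p : N) :
    tauAux ψ p w = ctxWord ψ p w 1 := by
  induction w generalizing p with
  | nil => rfl
  | cons a w ih => rw [tauAux, ctxWord, ih, mul_one]

theorem ctxWord_append (ψ : FreeMonoid A →* N) (u v : List A) (p q : N) :
    ctxWord ψ p (u ++ v) q =
      ctxWord ψ p u (ψ (FreeMonoid.ofList v) * q) ++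
        ctxWord ψ (p * ψ (FreeMonoid.ofList u)) v q := by
  induction u generalizing p with
  | nil => simp [ctxWord]
  | cons a u ih =>
    simp [ctxWord, ih, FreeMonoid.ofList_cons, FreeMonoid.ofList_append, mul_assoc]

/-- The words all of whose letters fix `p` on the right and `q` on the left. -/
def loopWords (ψ : FreeMonoid A →* N) (p q : N) : Submonoid (FreeMonoid A) where
  carrier := {w | ∀ a ∈ FreeMonoid.toList w,
    p * ψ (FreeMonoid.of a) = p ∧ ψ (FreeMonoid.of a) * q = q}
  one_mem' := by simp
  mul_mem' := by
    intro u v hu hv a ha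
    rw [FreeMonoid.toList_mul, List.mem_append] at ha
    exact ha.elim (hu a) (hv a)

theorem loopWords_spec {ψ : FreeMonoid A →* N} {p q : N} {w : List A}
    (hw : FreeMonoid.ofList w ∈ loopWords ψ p q) :
    p * ψ (FreeMonoid.ofList w) = p ∧ ψ (FreeMonoid.ofList w) * q = q ∧
      ctxWord ψ p w q = w.map fun a => (p, a, q) := by
  induction w with
  | nil => simp [ctxWord]
  | cons a w ih =>
    obtain ⟨h1, h2⟩ := hw a (by simp)
    obtain ⟨h3, h4, h5⟩ := ih fun b hb => hw b (by simpa using Or.inr hb)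
    rw [FreeMonoid.ofList_cons, map_mul, ctxWord, List.map_cons, mul_assoc, h4, h1, h5,
      ← mul_assoc, h1]
    exact ⟨h3, h2, rfl⟩

theorem eq_of_loopWords {L K : Type} [Monoid L] [Monoid K] {φ : FreeMonoid A →* L}
    {ψ : FreeMonoid A →* N} {h : FreeMonoid (N × A × N) →* K}
    (hφ : ∀ v w, ψ v = ψ w → h (tau ψ v) = h (tau ψ w) → φ v = φ w) (P Q : FreeMonoid A)
    {U V : FreeMonoid A} (hU : U ∈ loopWords ψ (ψ P) (ψ Q)) (hV : V ∈ loopWords ψ (ψ P) (ψ Q))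
    (hUV : ∀ g : FreeMonoid A →* K, g U = g V) :
    φ (P * U * Q) = φ (P * V * Q) := by
  obtain ⟨hU1, hU2, hU3⟩ := loopWords_spec (w := FreeMonoid.toList U) hU
  obtain ⟨hV1, hV2, hV3⟩ := loopWords_spec (w := FreeMonoid.toList V) hV
  rw [FreeMonoid.ofList_toList] at hU1 hU2 hV1 hV2
  refine hφ _ _ (by simp [hU1, hV1]) ?_
  have key := hUV (h.comp (FreeMonoid.map fun a => (ψ P, a, ψ Q)))
  have hsplit : ∀ W : FreeMonoid A, tau ψ (P * W * Q) =
      FreeMonoid.ofList (ctxWord ψ 1 (FreeMonoid.toList P) (ψ W * ψ Q)) *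
        FreeMonoid.ofList (ctxWord ψ (ψ P) (FreeMonoid.toList W) (ψ Q)) *
        FreeMonoid.ofList (ctxWord ψ (ψ P * ψ W) (FreeMonoid.toList Q) 1) := by
    intro W
    simp [tau, tauAux_eq_ctxWord, ctxWord_append, FreeMonoid.ofList_append, FreeMonoid.toList_mul,
      mul_assoc]
  rw [hsplit, hsplit, hU2, hV2, hU1, hV1, hU3, hV3]
  simp only [map_mul]
  congr 2

theorem JTrivial.mul_right_eq_of_mem (hN : JTrivial N) {r : N} {l : List N}
    (h : r * l.prod = r) {x : N} (hx : x ∈ l) : r * x = r := by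
  induction l with
  | nil => simp at hx
  | cons y l ih =>
    rw [List.prod_cons, ← mul_assoc] at h
    have hy := hN.mul_right_eq h
    rw [hy] at h
    rcases List.mem_cons.1 hx with rfl | hx
    exacts [hy, ih h hx]

theorem JTrivial.mul_left_eq_of_mem (hN : JTrivial N) {r : N} {l : List N}
    (h : l.prod * r = r) {x : N} (hx : x ∈ l) : x * r = r := by
  induction l with
  | nil => simp at hx
  | cons y l ih =>
    rw [List.prod_cons, mul_assoc] at h
    have hy := hN.mul_left_eq h
    rw [hy] at h
    rcases List.mem_cons.1 hx with rfl | hx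
    exacts [h, ih hy hx]

theorem map_eq_prod_toList (ψ : FreeMonoid A →* N) (w : FreeMonoid A) :
    ψ w = ((FreeMonoid.toList w).map fun a => ψ (FreeMonoid.of a)).prod := by
  conv_lhs => rw [← FreeMonoid.lift_restrict ψ]
  rw [FreeMonoid.lift_apply]
  rfl

theorem JTrivial.mem_loopWords (hN : JTrivial N) {ψ : FreeMonoid A →* N} {p q : N}
    {w : FreeMonoid A} (hp : p * ψ w = p) (hq : ψ w * q = q) : w ∈ loopWords ψ p q := by
  rw [map_eq_prod_toList] at hp hq
  exact fun a ha => ⟨hN.mul_right_eq_of_mem hp (List.mem_map_of_mem ha),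
    hN.mul_left_eq_of_mem hq (List.mem_map_of_mem ha)⟩

theorem MemBlockJ.exists_satE {P : BFinMonoid → Prop} {n : ℕ}
    (hP : ∀ K, P K → ∃ e, SatE e n K.carrier) {M : BFinMonoid} (hM : MemBlockJ P M) :
    ∃ e, SatE e (n + 1) M.carrier := by
  obtain ⟨A, _, φ, hφ, N, ψ, hN, K, h, hK, H⟩ := hM
  obtain ⟨e₁, h₁⟩ := hP K hK
  obtain ⟨e₂, h₂⟩ := jTrivial_iff_exists_satE.1 hN
  obtain ⟨e, hK, hN'⟩ : ∃ e, SatE e n K.carrier ∧ SatE e 0 N.carrier :=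
    ⟨_, h₁.mono (le_max_left _ _), h₂.mono (le_max_right e₁ e₂)⟩
  have hap : ∀ x : M.carrier, x ^ (e + e + e + 1) = x ^ (e + e + e) := by
    intro x
    obtain ⟨w, rfl⟩ := hφ x
    have hw : w ∈ loopWords ψ (ψ (w ^ e)) (ψ (w ^ e)) := by
      apply hN.mem_loopWords <;> rw [map_pow]
      · rw [← pow_succ, hN'.1]
      · rw [← pow_succ', hN'.1]
    have := eq_of_loopWords H (w ^ e) (w ^ e) (Submonoid.pow_mem _ hw (e + 1))
      (Submonoid.pow_mem _ hw e) (fun g => by simp only [map_pow, hK.1])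
    rw [← pow_add, ← pow_add, ← pow_add, ← pow_add, map_pow, map_pow] at this
    convert this using 2
    omega
  replace hK := hK.mono (show e ≤ e + e + e by omega)
  replace hN' := hN'.mono (show e ≤ e + e + e by omega)
  generalize e + e + e = f at *
  refine ⟨f, hap, fun X => ?_⟩
  choose W hW using fun i => hφ (X i)
  obtain rfl : (fun i => φ (W i)) = X := funext hW
  set p := chainProd W (2 * (n + 1) + 1) ^ f with hp
  set q := (W (2 * (n + 1) + 2) * chainProd W (2 * (n + 1))) ^ f with hq
  have hmem : ∀ i, 1 ≤ i → i ≤ 2 * n + 2 → W i ∈ loopWords ψ (ψ p) (ψ q) := by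
    intro i h1 h2
    have hi : ψ (W i) ∈ (List.range (2 * (n + 1))).map fun i => ψ (W (i + 1)) :=
      List.mem_map.2 ⟨i - 1, List.mem_range.2 (by omega), by rw [Nat.sub_add_cancel h1]⟩
    have hc : ((List.range (2 * (n + 1))).map fun i => ψ (W (i + 1))).prod =
        ψ (chainProd W (2 * (n + 1))) := (map_chainProd ψ W _).symm
    apply hN.mem_loopWords
    · refine hN.mul_right_eq_of_mem
        (l := ((List.range (2 * (n + 1))).map fun i => ψ (W (i + 1))) ++
          [ψ (W (2 * (n + 1) + 1))]) ?_ (List.mem_append_left _ hi)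
      rw [List.prod_append, hc, List.prod_singleton, ← map_mul, ← chainProd_succ, hp, map_pow,
        ← pow_succ, hN'.1]
    · refine hN.mul_left_eq_of_mem
        (l := ψ (W (2 * (n + 1) + 2)) ::
          ((List.range (2 * (n + 1))).map fun i => ψ (W (i + 1)))) ?_ (List.mem_cons_of_mem _ hi)
      rw [List.prod_cons, hc, ← map_mul, hq, map_pow, ← pow_succ', hN'.1]
  have h1 := hmem 1 le_rfl (by omega)
  have h2 := hmem 2 (by omega) (by omega)
  have := eq_of_loopWords H p q
    (wrap_mem _ (Submonoid.pow_mem _ (mul_mem h1 h2) f) (e := f) hmem)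
    (wrap_mem _ (Submonoid.pow_mem _ (mul_mem h2 h1) f) (e := f) hmem)
    (fun g => by simpa only [map_wrap, map_pow, map_mul] using hK.2 fun i => g (W i))
  have hX : ∀ b, φ (p * wrap f W b n * q) = wrap f (fun i => φ (W i)) (φ b) (n + 1) :=
    fun b => map_wrap φ f W b (n + 1)
  rw [hX, hX] at this
  simpa only [map_pow, map_mul] using this

end Transduction

section Subwords

/-- Simon's congruence: two words are related if they have the same scattered subwords of length
at most `k`. -/
def subwordCon (B : Type) (k : ℕ) : Con (FreeMonoid B) where
  r u v := ∀ t : List B, t.length ≤ k →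
    (t.Sublist (FreeMonoid.toList u) ↔ t.Sublist (FreeMonoid.toList v))
  iseqv := ⟨fun _ _ _ => Iff.rfl, fun h t ht => (h t ht).symm,
    fun h h' t ht => (h t ht).trans (h' t ht)⟩
  mul' := by
    intro u v u' v' h h' t ht
    simp only [FreeMonoid.toList_mul, List.sublist_append_iff]
    refine exists_congr fun t₁ => exists_congr fun t₂ => and_congr_right fun hT => ?_
    rw [hT, List.length_append] at ht
    exact and_congr (h t₁ (by omega)) (h' t₂ (by omega))

theorem subwordCon_iff {B : Type} {k : ℕ} {u v : FreeMonoid B} :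
    (u : (subwordCon B k).Quotient) = v ↔ ∀ t : List B, t.length ≤ k →
      (t.Sublist (FreeMonoid.toList u) ↔ t.Sublist (FreeMonoid.toList v)) :=
  Con.eq _

instance {B : Type} [Finite B] (k : ℕ) : Finite (subwordCon B k).Quotient := by
  have : Finite {t : List B // t.length ≤ k} := (List.finite_length_le B k).to_subtype
  let f : (subwordCon B k).Quotient → Set {t : List B // t.length ≤ k} :=
    fun x => Con.liftOn x (fun u => {t | t.1.Sublist (FreeMonoid.toList u)})
      fun u v h => Set.ext fun t => h t.1 t.2
  refine Finite.of_injective f fun x y => ?_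
  induction x using Con.induction_on with | _ u
  induction y using Con.induction_on with | _ v
  intro h
  exact subwordCon_iff.2 fun t ht => Set.ext_iff.1 h ⟨t, ht⟩

theorem jTrivial_subwordCon (B : Type) (k : ℕ) : JTrivial (subwordCon B k).Quotient := by
  refine jTrivial_iff.2 fun s t a b c d => ?_
  induction s using Con.induction_on with | _ s
  induction t using Con.induction_on with | _ t
  induction a using Con.induction_on with | _ a
  induction b using Con.induction_on with | _ b
  induction c using Con.induction_on with | _ c
  induction d using Con.induction_on with | _ d
  simp only [← Con.coe_mul, subwordCon_iff]
  have key : ∀ x y z : FreeMonoid B,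
      (FreeMonoid.toList y).Sublist (FreeMonoid.toList (x * y * z)) := by
    intro x y z
    simp only [FreeMonoid.toList_mul]
    exact (List.sublist_append_right _ _).trans (List.sublist_append_left _ _)
  exact fun hs ht u hu => ⟨fun h => (ht u hu).1 (h.trans (key _ _ _)),
    fun h => (hs u hu).1 (h.trans (key _ _ _))⟩

/-- If appending the letter `a` to `s` leaves the `R`-class of `m · s`, then `s ++ [a]` has a
short subword that `s` does not have; its first letter leaves the `R`-class of `m`. -/
theorem exists_short_subword {A M : Type} [Monoid M] [Finite M] (f : A → M)
    (hR : ∀ m p a q : M, m * p * a * q = m → ∃ z, m * a * z = m) (a : A) (s : List A) (m : M)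
    (h : ¬ ∃ z, m * (s.map f).prod * f a * z = m * (s.map f).prod) :
    ∃ b t, (¬ ∃ z, m * f b * z = m) ∧ (b :: t).length ≤ {x | ∃ y, m * y = x}.ncard ∧
      (b :: t).Sublist (s ++ [a]) ∧ ¬ (b :: t).Sublist s := by
  induction s generalizing m with
  | nil =>
    refine ⟨a, [], by simpa using h, ?_, by simp, by simp⟩
    exact Nat.succ_le_of_lt ((Set.ncard_pos (Set.toFinite _)).2 ⟨m, 1, mul_one m⟩)
  | cons c s ih =>
    rw [List.map_cons, List.prod_cons, ← mul_assoc] at h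
    obtain ⟨b, t, hb, hlen, hsub, hnot⟩ := ih (m * f c) h
    have hss : {x | ∃ y, m * f c * y = x} ⊆ {x | ∃ y, m * y = x} := by
      rintro _ ⟨y, rfl⟩
      exact ⟨f c * y, (mul_assoc _ _ _).symm⟩
    by_cases hc : ∃ z, m * f c * z = m
    · obtain ⟨z, hz⟩ := hc
      refine ⟨b, t, ?_, hlen.trans (Set.ncard_le_ncard hss (Set.toFinite _)),
        hsub.trans (List.sublist_cons_self _ _), fun hcon => ?_⟩
      · rintro ⟨y, hy⟩
        refine hb (hR (m * f c) z (f b) (y * f c) ?_)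
        rw [hz, ← mul_assoc, hy]
      · cases hcon with
        | cons _ h => exact hnot h
        | cons_cons _ h => exact hb (hR (m * f c) z (f c) 1 (by rw [hz, mul_one]))
    · refine ⟨c, b :: t, hc, ?_, hsub.cons_cons c, fun hcon => hnot (List.cons_sublist_cons.1 hcon)⟩
      rw [List.length_cons]
      refine Nat.succ_le_of_lt (hlen.trans_lt (Set.ncard_lt_ncard ?_ (Set.toFinite _)))
      refine ⟨hss, fun hsub => hc ?_⟩
      exact hsub ⟨1, mul_one m⟩

theorem exists_mul_eq_of_subwordCon {A M : Type} [Monoid M] [Finite M] (φ : FreeMonoid A →* M)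
    (hR : ∀ m p a q : M, m * p * a * q = m → ∃ z, m * a * z = m) (s : FreeMonoid A) (a : A)
    (h : (s : (subwordCon A (Nat.card M)).Quotient) * (FreeMonoid.of a : FreeMonoid A) = s) :
    ∃ z, φ s * φ (FreeMonoid.of a) * z = φ s := by
  by_contra hcon
  obtain ⟨b, t, -, hlen, hsub, hnot⟩ := exists_short_subword (fun a => φ (FreeMonoid.of a)) hR a
    (FreeMonoid.toList s) 1 (by rwa [← map_eq_prod_toList, one_mul])
  rw [← Con.coe_mul, subwordCon_iff] at h
  exact hnot ((h _ (hlen.trans (Set.ncard_le_card _))).1 hsub)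

theorem exists_mul_eq_of_subwordCon' {A M : Type} [Monoid M] [Finite M] (φ : FreeMonoid A →* M)
    (hL : ∀ m p a q : M, q * (a * (p * m)) = m → ∃ z, z * (a * m) = m) (s : FreeMonoid A) (a : A)
    (h : ((FreeMonoid.of a : FreeMonoid A) : (subwordCon A (Nat.card M)).Quotient) * s = s) :
    ∃ z, z * (φ (FreeMonoid.of a) * φ s) = φ s := by
  by_contra hcon
  have : Finite Mᵐᵒᵖ := .of_equiv M MulOpposite.opEquiv
  have hprod : ((FreeMonoid.toList s).reverse.map
      fun a => MulOpposite.op (φ (FreeMonoid.of a))).prod = MulOpposite.op (φ s) := by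
    rw [map_eq_prod_toList φ s, MulOpposite.op_list_prod, List.map_map, ← List.map_reverse]
    rfl
  obtain ⟨b, t, -, hlen, hsub, hnot⟩ := exists_short_subword
    (fun a => MulOpposite.op (φ (FreeMonoid.of a))) (fun m p a q h => by
      obtain ⟨z, hz⟩ := hL m.unop p.unop a.unop q.unop (congrArg MulOpposite.unop h)
      exact ⟨MulOpposite.op z, congrArg MulOpposite.op hz⟩) a
    (FreeMonoid.toList s).reverse 1 (by
      rw [hprod, one_mul]
      rintro ⟨z, hz⟩
      exact hcon ⟨z.unop, congrArg MulOpposite.unop hz⟩)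
  rw [← Con.coe_mul, subwordCon_iff] at h
  have hcard : Nat.card Mᵐᵒᵖ = Nat.card M := Nat.card_congr MulOpposite.opEquiv.symm
  have := (h (b :: t).reverse (by
    rw [List.length_reverse, ← hcard]; exact hlen.trans (Set.ncard_le_card _))).1 (by
      rw [← List.reverse_sublist]
      simpa using hsub)
  exact hnot (by rw [← List.reverse_sublist]; simpa using this)

end Subwords

section StableFactors

variable {M : Type} [Monoid M] {e n : ℕ}

theorem SatE.pow_mul_pow (h : SatE e n M) (x : M) : x ^ e * x ^ e = x ^ e := by
  rw [← pow_add, pow_eq_of_le (h.1 x) (Nat.le_add_left _ _)]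

theorem SatE.pow_mul_pow_mul_pow (h : SatE e n M) (x y : M) :
    (x * y) ^ e * (y * x) ^ e * (x * y) ^ e = (x * y) ^ e := by
  set X : ℕ → M := fun i => if i = 1 then x else if i = 2 then y else 1 with hX
  have hchain : ∀ k, chainProd X (k + 2) = x * y := by
    intro k
    induction k with
    | zero => simp [chainProd_succ, hX]; simp [chainProd]
    | succ k ih => rw [chainProd_succ, ih]; simp [hX]
  have hE := h.pow_mul_pow (x * y)
  have hwrap : ∀ b m, (x * y) ^ e * wrap e X b m * (x * y) ^ e =
      (x * y) ^ e * b * (x * y) ^ e := by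
    intro b m
    induction m with
    | zero => rfl
    | succ m ih =>
      have h3 : X (2 * (m + 1) + 2) = 1 := by simp [hX]
      rw [wrap, show 2 * (m + 1) + 1 = 2 * m + 1 + 2 by ring, hchain,
        show chainProd X (2 * (m + 1)) = x * y from hchain (2 * m), h3, one_mul]
      simp only [mul_assoc, hE] at ih ⊢
      rw [← mul_assoc ((x * y) ^ e) ((x * y) ^ e), hE, ih]
  have := h.2 X
  rw [← hwrap, show y * x = X 2 * X 1 by simp [hX], ← this, hwrap,
    show X 1 * X 2 = x * y by simp [hX], hE, hE]

theorem SatE.exists_mul_right_eq (h : SatE e n M) {m p a q : M} (hm : m * p * a * q = m) :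
    ∃ z, m * a * z = m := by
  have hk : ∀ k, m * (p * (a * q)) ^ k = m := by
    intro k
    induction k with
    | zero => simp
    | succ k ih => rw [pow_succ', ← mul_assoc, ← mul_assoc, ← mul_assoc, hm, ih]
  have h' := h.mono e.le_succ
  have key := h'.pow_mul_pow_mul_pow p (a * q)
  refine ⟨q * (p * (a * q * p) ^ e * (p * (a * q)) ^ (e + 1)), ?_⟩
  calc _ = m * (p * (a * q)) ^ (e + 1) * (a * q * p) ^ (e + 1) * (p * (a * q)) ^ (e + 1) := by
        rw [hk, pow_succ' (a * q * p)]; simp only [mul_assoc]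
    _ = m := by rw [mul_assoc, mul_assoc, ← mul_assoc (_ ^ _), key, hk]

theorem SatE.exists_mul_left_eq (h : SatE e n M) {m p a q : M} (hm : q * (a * (p * m)) = m) :
    ∃ z, z * (a * m) = m := by
  have hk : ∀ k, ((q * a) * p) ^ k * m = m := by
    intro k
    induction k with
    | zero => simp
    | succ k ih =>
      rw [pow_succ, mul_assoc, show q * a * p * m = m by simpa only [mul_assoc] using hm, ih]
  have h' := h.mono e.le_succ
  have key := h'.pow_mul_pow_mul_pow (q * a) p
  refine ⟨((q * a) * p) ^ (e + 1) * (p * (q * a)) ^ e * p * q, ?_⟩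
  calc _ = ((q * a) * p) ^ (e + 1) * (p * (q * a)) ^ (e + 1) * (((q * a) * p) ^ (e + 1) * m) := by
        rw [hk, pow_succ (p * (q * a))]; simp only [mul_assoc]
    _ = m := by rw [← mul_assoc, key, hk]

end StableFactors

section LocalMonoids

variable {M : Type} [Monoid M]

/-- The elements that act on `S` from the right and on `T` from the left without leaving the `R`-
and `L`-classes. -/
def stab (S T : Set M) : Submonoid M where
  carrier := {x | (∀ s ∈ S, s * x ∈ S ∧ ∃ z, s * x * z = s) ∧
    ∀ t ∈ T, x * t ∈ T ∧ ∃ z, z * (x * t) = t}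
  one_mem' := ⟨fun s hs => ⟨by simpa, 1, by simp⟩, fun t ht => ⟨by simpa, 1, by simp⟩⟩
  mul_mem' := by
    rintro x y ⟨hx, hx'⟩ ⟨hy, hy'⟩
    refine ⟨fun s hs => ?_, fun t ht => ?_⟩
    · obtain ⟨h1, z, hz⟩ := hx s hs
      obtain ⟨h2, w, hw⟩ := hy _ h1
      exact ⟨by rwa [← mul_assoc], w * z, by rw [← mul_assoc, ← mul_assoc, hw, hz]⟩
    · obtain ⟨h1, z, hz⟩ := hy' t ht
      obtain ⟨h2, w, hw⟩ := hx' _ h1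
      exact ⟨by rwa [mul_assoc], z * w, by rw [mul_assoc, mul_assoc, hw, hz]⟩

/-- Two elements of `stab S T` are related if they are equal in every context from `S × T`. -/
def localCon (S T : Set M) : Con (stab S T) where
  r x y := ∀ s ∈ S, ∀ t ∈ T, s * (x : M) * t = s * (y : M) * t
  iseqv := ⟨fun _ _ _ _ _ => rfl, fun h s hs t ht => (h s hs t ht).symm,
    fun h h' s hs t ht => (h s hs t ht).trans (h' s hs t ht)⟩
  mul' := by
    intro x y x' y' h h' s hs t ht
    have h1 := h s hs _ (x'.2.2 t ht).1
    have h2 := h' _ (y.2.1 s hs).1 t ht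
    simp only [Submonoid.coe_mul, mul_assoc] at h1 h2 ⊢
    rw [h1, h2]

theorem SatE.quotient_localCon {e n : ℕ} (h : SatE e (n + 1) M) (S T : Set M) :
    SatE e n (localCon S T).Quotient where
  pow_succ_eq x := by
    induction x using Con.induction_on with | _ x
    exact congrArg (localCon S T).mk' (Subtype.ext (h.1 x) : x ^ (e + 1) = x ^ e)
  wrap_eq X := by
    choose x hx using fun i => Con.mk'_surjective (c := localCon S T) (X i)
    obtain rfl : (fun i => (localCon S T).mk' (x i)) = X := funext hx
    simp only [← map_mul, ← map_pow, ← map_wrap]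
    refine (Con.eq _).2 fun s hs t ht => ?_
    simp only [← Submonoid.subtype_apply, map_wrap, map_pow, map_mul]
    have hc : chainProd (fun i => (x i : M)) (2 * (n + 1)) ∈ stab S T :=
      chainProd_mem _ fun i _ _ => (x i).2
    obtain ⟨z, hz⟩ := (hc.1 s hs).2
    obtain ⟨z', hz'⟩ := (hc.2 t ht).2
    have hs' : ∀ k, s * (chainProd (fun i => (x i : M)) (2 * (n + 1)) * z) ^ k = s := by
      intro k
      induction k with
      | zero => simp
      | succ k ih => rw [pow_succ', ← mul_assoc, ← mul_assoc, hz, ih]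
    have ht' : ∀ k, (z' * chainProd (fun i => (x i : M)) (2 * (n + 1))) ^ k * t = t := by
      intro k
      induction k with
      | zero => simp
      | succ k ih => rw [pow_succ, mul_assoc, mul_assoc, hz', ih]
    set Y : ℕ → M := fun i => if i = 2 * (n + 1) + 1 then z else
      if i = 2 * (n + 1) + 2 then z' else x i with hY
    have hYx : ∀ i, 1 ≤ i → i ≤ 2 * n + 2 → (x i : M) = Y i := by
      intro i _ h2
      simp [hY, show i ≠ 2 * (n + 1) + 1 by omega, show i ≠ 2 * (n + 1) + 2 by omega]
    have key : ∀ b, s * wrap e (fun i => (x i : M)) b n * t = s * wrap e Y b (n + 1) * t := by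
      intro b
      rw [wrap, chainProd_succ, ← chainProd_congr (k := 2 * (n + 1)) hYx,
        ← wrap_congr hYx]
      have h1 : Y (2 * (n + 1) + 1) = z := by simp [hY]
      have h2 : Y (2 * (n + 1) + 2) = z' := by simp [hY]
      rw [h1, h2]
      conv_lhs => rw [← hs' e, ← ht' e]
      simp only [mul_assoc]
    change s * wrap e (fun i => (x i : M)) (((x 1 : M) * (x 2 : M)) ^ e) n * t =
      s * wrap e (fun i => (x i : M)) (((x 2 : M) * (x 1 : M)) ^ e) n * t
    rw [key, key, hYx 1 le_rfl (by omega), hYx 2 (by omega) (by omega), h.2 Y]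

end LocalMonoids

section Decomposition

variable {A N M : Type} [Monoid N] [Monoid M]

/-- The letter `(p, a, q)` does not change the contexts. -/
def IsLoop (ψ : FreeMonoid A →* N) (b : N × A × N) : Prop :=
  b.1 * ψ (FreeMonoid.of b.2.1) = b.1 ∧ ψ (FreeMonoid.of b.2.1) * b.2.2 = b.2.2

/-- The monoid of loops at the object `(p, q)`, seen through `φ`. -/
abbrev LoopMonoid (φ : FreeMonoid A →* M) (ψ : FreeMonoid A →* N) (c : N × N) : Type :=
  (localCon (φ '' {s | ψ s = c.1}) (φ '' {t | ψ t = c.2})).Quotient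

open Classical in
/-- The value in the loop monoid at `c` of the loops at `c` in a word. -/
noncomputable def loopHom (φ : FreeMonoid A →* M) (ψ : FreeMonoid A →* N) (c : N × N) :
    FreeMonoid (N × A × N) →* LoopMonoid φ ψ c :=
  FreeMonoid.lift fun b =>
    if h : φ (FreeMonoid.of b.2.1) ∈ stab (φ '' {s | ψ s = c.1}) (φ '' {t | ψ t = c.2}) ∧
        IsLoop ψ b ∧ (b.1, b.2.2) = c then
      ((⟨_, h.1⟩ : stab _ _) : LoopMonoid φ ψ c)
    else 1

open Classical in
/-- The letters of a word that are not loops. -/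
noncomputable def nonloops (ψ : FreeMonoid A →* N) (l : List (N × A × N)) : List (N × A × N) :=
  l.filter fun b => ¬ IsLoop ψ b

open Classical in
/-- The homomorphism erasing the loops of a word. -/
noncomputable def nonloopHom (ψ : FreeMonoid A →* N) :
    FreeMonoid (N × A × N) →* FreeMonoid (N × A × N) :=
  FreeMonoid.lift fun b => if IsLoop ψ b then 1 else FreeMonoid.of b

theorem nonloops_ctxWord_cons_of_isLoop {ψ : FreeMonoid A →* N} {p q : N} {a : A} {w : List A}
    (h : IsLoop ψ (p, a, ψ (FreeMonoid.ofList w) * q)) :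
    nonloops ψ (ctxWord ψ p (a :: w) q) = nonloops ψ (ctxWord ψ p w q) := by
  have hp : p * ψ (FreeMonoid.of a) = p := h.1
  simp [nonloops, ctxWord, h, hp]

theorem nonloops_ctxWord_cons_of_not_isLoop {ψ : FreeMonoid A →* N} {p q : N} {a : A}
    {w : List A} (h : ¬ IsLoop ψ (p, a, ψ (FreeMonoid.ofList w) * q)) :
    nonloops ψ (ctxWord ψ p (a :: w) q) = (p, a, ψ (FreeMonoid.ofList w) * q) ::
      nonloops ψ (ctxWord ψ (p * ψ (FreeMonoid.of a)) w q) := by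
  simp [nonloops, ctxWord, h]

theorem nonloopHom_ofList (ψ : FreeMonoid A →* N) (l : List (N × A × N)) :
    nonloopHom ψ (FreeMonoid.ofList l) = FreeMonoid.ofList (nonloops ψ l) := by
  induction l with
  | nil => simp [nonloops]
  | cons b l ih =>
    rw [FreeMonoid.ofList_cons, map_mul, ih]
    by_cases h : IsLoop ψ b <;> simp [nonloopHom, nonloops, h, FreeMonoid.ofList_cons]

theorem exists_of_mem_ctxWord {ψ : FreeMonoid A →* N} {w : List A} {p q : N} {b : N × A × N}
    (hb : b ∈ ctxWord ψ p w q) : (∃ x, b.1 = p * x) ∧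
      ∃ y, ψ (FreeMonoid.ofList w) * q = y * (ψ (FreeMonoid.of b.2.1) * b.2.2) := by
  induction w generalizing p with
  | nil => simp [ctxWord] at hb
  | cons a w ih =>
    rw [ctxWord, List.mem_cons] at hb
    rcases hb with rfl | hb
    · exact ⟨⟨1, by simp⟩, 1, by simp [FreeMonoid.ofList_cons, mul_assoc]⟩
    · obtain ⟨⟨x, hx⟩, y, hy⟩ := ih hb
      exact ⟨⟨_, by rw [hx, mul_assoc]⟩, ψ (FreeMonoid.of a) * y, by
        rw [FreeMonoid.ofList_cons, map_mul, mul_assoc, hy, mul_assoc]⟩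

theorem isLoop_of_mem_ctxWord (hN : JTrivial N) {ψ : FreeMonoid A →* N} {w : List A}
    {p q : N} {a : A} {b : N × A × N} (hb : b ∈ ctxWord ψ (p * ψ (FreeMonoid.of a)) w q)
    (hp : b.1 = p) (hq : ∃ y, ψ (FreeMonoid.of b.2.1) * b.2.2 =
      y * (ψ (FreeMonoid.of a) * (ψ (FreeMonoid.ofList w) * q))) :
    IsLoop ψ (p, a, ψ (FreeMonoid.ofList w) * q) := by
  obtain ⟨⟨x, hx⟩, y, hy⟩ := exists_of_mem_ctxWord hb
  obtain ⟨z, hz⟩ := hq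
  refine ⟨hN.mul_right_eq (y := x) (by rw [← hx, hp]), hN.mul_left_eq (y := y * z) ?_⟩
  rw [mul_assoc, ← hz, ← hy]

theorem nodup_nonloops (hN : JTrivial N) (ψ : FreeMonoid A →* N) (w : List A) (p q : N) :
    (nonloops ψ (ctxWord ψ p w q)).Nodup := by
  induction w generalizing p with
  | nil => simp [ctxWord, nonloops]
  | cons a w ih =>
    by_cases h : IsLoop ψ (p, a, ψ (FreeMonoid.ofList w) * q)
    · rw [nonloops_ctxWord_cons_of_isLoop h]
      exact ih p
    · rw [nonloops_ctxWord_cons_of_not_isLoop h]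
      exact List.nodup_cons.2 ⟨fun hmem => h (isLoop_of_mem_ctxWord hN
        (List.mem_of_mem_filter hmem) rfl ⟨1, by simp⟩), ih _⟩

theorem loopHom_eq_one {φ : FreeMonoid A →* M} {ψ : FreeMonoid A →* N} {c : N × N}
    {l : List (N × A × N)} (h : ∀ b ∈ l, IsLoop ψ b → (b.1, b.2.2) ≠ c) :
    loopHom φ ψ c (FreeMonoid.ofList l) = 1 := by
  induction l with
  | nil => simp
  | cons b l ih =>
    rw [FreeMonoid.ofList_cons, map_mul, ih fun b hb => h b (List.mem_cons_of_mem _ hb), mul_one,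
      loopHom, FreeMonoid.lift_eval_of, dif_neg]
    exact fun hb => h b List.mem_cons_self hb.2.1 hb.2.2

theorem map_of_mem_stab {φ : FreeMonoid A →* M} {ψ : FreeMonoid A →* N}
    (hR : ∀ s a, ψ s * ψ (FreeMonoid.of a) = ψ s → ∃ z, φ s * φ (FreeMonoid.of a) * z = φ s)
    (hL : ∀ s a, ψ (FreeMonoid.of a) * ψ s = ψ s → ∃ z, z * (φ (FreeMonoid.of a) * φ s) = φ s)
    {p q : N} {a : A} (hp : p * ψ (FreeMonoid.of a) = p) (hq : ψ (FreeMonoid.of a) * q = q) :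
    φ (FreeMonoid.of a) ∈ stab (φ '' {s | ψ s = p}) (φ '' {t | ψ t = q}) := by
  constructor
  · rintro _ ⟨s, rfl, rfl⟩
    exact ⟨⟨s * FreeMonoid.of a, by simpa using hp, map_mul _ _ _⟩, hR s a hp⟩
  · rintro _ ⟨t, rfl, rfl⟩
    exact ⟨⟨FreeMonoid.of a * t, by simpa using hq, map_mul _ _ _⟩, hL t a hq⟩

theorem loopHom_of_loopWords {φ : FreeMonoid A →* M} {ψ : FreeMonoid A →* N}
    (hR : ∀ s a, ψ s * ψ (FreeMonoid.of a) = ψ s → ∃ z, φ s * φ (FreeMonoid.of a) * z = φ s)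
    (hL : ∀ s a, ψ (FreeMonoid.of a) * ψ s = ψ s → ∃ z, z * (φ (FreeMonoid.of a) * φ s) = φ s)
    {p q : N} {w : List A} (hw : FreeMonoid.ofList w ∈ loopWords ψ p q) :
    ∃ h : φ (FreeMonoid.ofList w) ∈ stab (φ '' {s | ψ s = p}) (φ '' {t | ψ t = q}),
      loopHom φ ψ (p, q) (FreeMonoid.ofList (ctxWord ψ p w q)) =
        ((⟨_, h⟩ : stab _ _) : LoopMonoid φ ψ (p, q)) := by
  rw [(loopWords_spec hw).2.2]
  induction w with
  | nil => exact ⟨by simp [one_mem], by simp; rfl⟩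
  | cons a w ih =>
    obtain ⟨h, ih⟩ := ih fun b hb => hw b (by simpa using Or.inr hb)
    obtain ⟨h1, h2⟩ := hw a (by simp)
    have ha := map_of_mem_stab hR hL h1 h2
    refine ⟨by rw [FreeMonoid.ofList_cons, map_mul]; exact mul_mem ha h, ?_⟩
    rw [List.map_cons, FreeMonoid.ofList_cons, map_mul, ih, loopHom, FreeMonoid.lift_eval_of,
      dif_pos ⟨ha, ⟨h1, h2⟩, rfl⟩, ← Con.coe_mul]
    congr 1
    exact Subtype.ext (by simp [FreeMonoid.ofList_cons])

theorem loopWords_of_nonloops_eq_nil {ψ : FreeMonoid A →* N} {w : List A} {p q : N}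
    (h : nonloops ψ (ctxWord ψ p w q) = []) : FreeMonoid.ofList w ∈ loopWords ψ p q := by
  induction w generalizing p with
  | nil => exact one_mem _
  | cons a w ih =>
    have hloop : IsLoop ψ (p, a, ψ (FreeMonoid.ofList w) * q) := by
      by_contra hcon
      simp [nonloops_ctxWord_cons_of_not_isLoop hcon] at h
    have hw := ih (nonloops_ctxWord_cons_of_isLoop hloop ▸ h)
    rw [FreeMonoid.ofList_cons]
    refine mul_mem ?_ hw
    intro b hb
    obtain rfl : b = a := by simpa using hb
    exact ⟨hloop.1, by simpa [(loopWords_spec hw).2.1] using hloop.2⟩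

theorem exists_append_of_nonloops_eq_cons {ψ : FreeMonoid A →* N} {w : List A} {p q : N}
    {b : N × A × N} {l : List (N × A × N)} (h : nonloops ψ (ctxWord ψ p w q) = b :: l) :
    ∃ u v, w = u ++ b.2.1 :: v ∧ b.1 = p ∧ b.2.2 = ψ (FreeMonoid.ofList v) * q ∧
      ¬ IsLoop ψ b ∧ FreeMonoid.ofList u ∈ loopWords ψ p (ψ (FreeMonoid.of b.2.1) * b.2.2) ∧
      nonloops ψ (ctxWord ψ (p * ψ (FreeMonoid.of b.2.1)) v q) = l := by
  induction w generalizing p with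
  | nil => simp [nonloops, ctxWord] at h
  | cons a w ih =>
    by_cases hloop : IsLoop ψ (p, a, ψ (FreeMonoid.ofList w) * q)
    · have hp : p * ψ (FreeMonoid.of a) = p := hloop.1
      obtain ⟨u, v, rfl, h1, h2, h3, h4, h5⟩ :=
        ih (nonloops_ctxWord_cons_of_isLoop hloop ▸ h)
      refine ⟨a :: u, v, rfl, h1, h2, h3, ?_, h5⟩
      rw [FreeMonoid.ofList_cons]
      refine mul_mem ?_ h4
      intro c hc
      obtain rfl : c = a := by simpa using hc
      refine ⟨hp, ?_⟩
      have hq := hloop.2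
      simpa only [FreeMonoid.ofList_append, FreeMonoid.ofList_cons, map_mul, mul_assoc, ← h2,
        (loopWords_spec h4).2.1] using hq
    · obtain ⟨rfl, rfl⟩ : (p, a, ψ (FreeMonoid.ofList w) * q) = b ∧
          nonloops ψ (ctxWord ψ (p * ψ (FreeMonoid.of a)) w q) = l := by
        simpa [nonloops_ctxWord_cons_of_not_isLoop hloop] using h
      exact ⟨[], w, rfl, rfl, rfl, hloop, one_mem _, rfl⟩

theorem loopHom_append_cons (hN : JTrivial N) {φ : FreeMonoid A →* M} {ψ : FreeMonoid A →* N}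
    {p q : N} {a : A} {u v : List A}
    (hu : FreeMonoid.ofList u ∈
      loopWords ψ p (ψ (FreeMonoid.of a) * (ψ (FreeMonoid.ofList v) * q)))
    (ha : ¬ IsLoop ψ (p, a, ψ (FreeMonoid.ofList v) * q)) (c : N × N) :
    let q' := ψ (FreeMonoid.of a) * (ψ (FreeMonoid.ofList v) * q)
    let t := FreeMonoid.ofList (ctxWord ψ p (u ++ a :: v) q)
    let t' := FreeMonoid.ofList (ctxWord ψ (p * ψ (FreeMonoid.of a)) v q)
    (c = (p, q') → loopHom φ ψ c t = loopHom φ ψ c (FreeMonoid.ofList (ctxWord ψ p u q')) ∧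
      loopHom φ ψ c t' = 1) ∧ (c ≠ (p, q') → loopHom φ ψ c t = loopHom φ ψ c t') := by
  intro q' t t'
  obtain ⟨h1, h2, h3⟩ := loopWords_spec hu
  have hat : loopHom φ ψ c (FreeMonoid.of (p, a, ψ (FreeMonoid.ofList v) * q)) = 1 :=
    loopHom_eq_one (l := [(p, a, ψ (FreeMonoid.ofList v) * q)]) fun b hb hl => by
      obtain rfl := List.mem_singleton.1 hb
      exact absurd hl ha
  have ht : loopHom φ ψ c t =
      loopHom φ ψ c (FreeMonoid.ofList (ctxWord ψ p u q')) * loopHom φ ψ c t' := by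
    simp only [t, ctxWord_append, ctxWord, h1, FreeMonoid.ofList_append, FreeMonoid.ofList_cons,
      map_mul, hat, one_mul, mul_assoc, q', t']
  refine ⟨fun hc => ?_, fun hc => ?_⟩
  · have : loopHom φ ψ c t' = 1 := by
      refine loopHom_eq_one fun b hb hl hbc => ha ?_
      rw [hc, Prod.mk.injEq] at hbc
      exact isLoop_of_mem_ctxWord hN hb hbc.1 ⟨1, by rw [hl.2, hbc.2, one_mul]⟩
    rw [ht, this, mul_one]
    exact ⟨rfl, rfl⟩
  · rw [ht, loopHom_eq_one, one_mul]
    intro b hb _ hbc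
    rw [h3] at hb
    obtain ⟨x, -, rfl⟩ := List.mem_map.1 hb
    exact hc hbc.symm

theorem mul_map_mul_eq (hN : JTrivial N) {φ : FreeMonoid A →* M} {ψ : FreeMonoid A →* N}
    (hR : ∀ s a, ψ s * ψ (FreeMonoid.of a) = ψ s → ∃ z, φ s * φ (FreeMonoid.of a) * z = φ s)
    (hL : ∀ s a, ψ (FreeMonoid.of a) * ψ s = ψ s → ∃ z, z * (φ (FreeMonoid.of a) * φ s) = φ s)
    {l : List (N × A × N)} {v w : List A} {s t : FreeMonoid A}
    (hv : nonloops ψ (ctxWord ψ (ψ s) v (ψ t)) = l)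
    (hw : nonloops ψ (ctxWord ψ (ψ s) w (ψ t)) = l)
    (hvw : ∀ c, loopHom φ ψ c (FreeMonoid.ofList (ctxWord ψ (ψ s) v (ψ t))) =
      loopHom φ ψ c (FreeMonoid.ofList (ctxWord ψ (ψ s) w (ψ t)))) :
    φ s * φ (FreeMonoid.ofList v) * φ t = φ s * φ (FreeMonoid.ofList w) * φ t := by
  have hlocal : ∀ {p q : N} {v w : List A} {s t : FreeMonoid A},
      FreeMonoid.ofList v ∈ loopWords ψ p q → FreeMonoid.ofList w ∈ loopWords ψ p q →
      loopHom φ ψ (p, q) (FreeMonoid.ofList (ctxWord ψ p v q)) =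
        loopHom φ ψ (p, q) (FreeMonoid.ofList (ctxWord ψ p w q)) → ψ s = p → ψ t = q →
      φ s * φ (FreeMonoid.ofList v) * φ t = φ s * φ (FreeMonoid.ofList w) * φ t := by
    intro p q v w s t hv hw h hs ht
    obtain ⟨_, h1⟩ := loopHom_of_loopWords hR hL hv
    obtain ⟨_, h2⟩ := loopHom_of_loopWords hR hL hw
    rw [h1, h2] at h
    exact (Con.eq _).1 h _ ⟨s, hs, rfl⟩ _ ⟨t, ht, rfl⟩
  induction l generalizing s v w with
  | nil =>
    exact hlocal (loopWords_of_nonloops_eq_nil hv) (loopWords_of_nonloops_eq_nil hw)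
      (hvw _) rfl rfl
  | cons b l ih =>
    obtain ⟨v₀, v₁, rfl, h1, h2, h3, h4, h5⟩ := exists_append_of_nonloops_eq_cons hv
    obtain ⟨w₀, w₁, rfl, -, h2', -, h4', h5'⟩ := exists_append_of_nonloops_eq_cons hw
    obtain ⟨p, a, q⟩ := b
    dsimp only at *
    subst h1 h2
    have hdv := fun c => loopHom_append_cons hN (φ := φ) h4 h3 c
    rw [h2'] at h3 h4'
    have hdw := fun c => loopHom_append_cons hN (φ := φ) h4' h3 c
    rw [← h2'] at hdw h4'
    have hloops := hlocal (s := s) (t := FreeMonoid.of a * FreeMonoid.ofList v₁ * t) h4 h4'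
      (by rw [← ((hdv _).1 rfl).1, ← ((hdw _).1 rfl).1, hvw]) rfl (by simp [mul_assoc])
    have hs : ψ (s * FreeMonoid.ofList w₀ * FreeMonoid.of a) = ψ s * ψ (FreeMonoid.of a) := by
      simp [(loopWords_spec h4').1]
    have key := ih (s := s * FreeMonoid.ofList w₀ * FreeMonoid.of a) (v := v₁) (w := w₁)
      (by rw [hs, h5]) (by rw [hs, h5']) (fun c => by
        rw [hs]
        by_cases hc : c = (ψ s, ψ (FreeMonoid.of a) * (ψ (FreeMonoid.ofList v₁) * ψ t))
        · rw [((hdv c).1 hc).2, ((hdw c).1 hc).2]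
        · rw [← (hdv c).2 hc, ← (hdw c).2 hc, hvw])
    simp only [FreeMonoid.ofList_append, FreeMonoid.ofList_cons, map_mul, mul_assoc] at *
    rw [hloops, key]

end Decomposition

section Main

theorem SatE.memBlockJ {e n : ℕ} {P : BFinMonoid → Prop}
    (hP : ∀ K : BFinMonoid, (∃ e, SatE e n K.carrier) → P K) {M : BFinMonoid}
    (h : SatE e (n + 1) M.carrier) : MemBlockJ P M := by
  let φ : FreeMonoid M.carrier →* M.carrier := FreeMonoid.lift id
  let N := (subwordCon M.carrier (Nat.card M.carrier)).Quotient
  let ψ : FreeMonoid M.carrier →* N := Con.mk' _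
  have hN : JTrivial N := jTrivial_subwordCon _ _
  let B := N × M.carrier × N
  let J := (subwordCon B (Nat.card B)).Quotient
  let K := J × ∀ c, LoopMonoid φ ψ c
  have hfin : ∀ c, Finite (LoopMonoid φ ψ c) := fun c =>
    Finite.of_surjective _ (Con.mk'_surjective (c := localCon _ _))
  let _ : Fintype N := Fintype.ofFinite _
  let _ : Fintype K := Fintype.ofFinite _
  let f : FreeMonoid B →* K :=
    ((Con.mk' _).comp (nonloopHom ψ)).prod (MonoidHom.pi fun c => loopHom φ ψ c)
  refine ⟨M.carrier, inferInstance, φ, fun m => ⟨FreeMonoid.of m, by simp [φ]⟩, ⟨N⟩, ψ, hN, ⟨K⟩, f,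
    hP _ ?_, fun v w _ hvw => ?_⟩
  · obtain ⟨e', he'⟩ := jTrivial_iff_exists_satE.1 (jTrivial_subwordCon B (Nat.card B))
    exact ⟨max e' e, .prod ((he'.of_zero n).mono (le_max_left _ _))
      (.pi fun c => (h.quotient_localCon _ _).mono (le_max_right _ _))⟩
  · have hR : ∀ s a, ψ s * ψ (FreeMonoid.of a) = ψ s →
        ∃ z, φ s * φ (FreeMonoid.of a) * z = φ s :=
      exists_mul_eq_of_subwordCon φ fun _ _ _ _ => h.exists_mul_right_eq
    have hL : ∀ s a, ψ (FreeMonoid.of a) * ψ s = ψ s →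
        ∃ z, z * (φ (FreeMonoid.of a) * φ s) = φ s :=
      exists_mul_eq_of_subwordCon' φ fun _ _ _ _ => h.exists_mul_left_eq
    rw [tau, tau, tauAux_eq_ctxWord, tauAux_eq_ctxWord] at hvw
    have h1 := (Con.eq _).1 (congrArg Prod.fst hvw)
    have h2 : ∀ c, loopHom φ ψ c (FreeMonoid.ofList (ctxWord ψ 1 (FreeMonoid.toList v) 1)) =
        loopHom φ ψ c (FreeMonoid.ofList (ctxWord ψ 1 (FreeMonoid.toList w) 1)) :=
      congrFun (congrArg Prod.snd hvw)
    rw [nonloopHom_ofList, nonloopHom_ofList] at h1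
    have hlen : ∀ u, (nonloops ψ (ctxWord ψ 1 u 1)).length ≤ Nat.card B := fun u =>
      (nodup_nonloops hN ψ u 1 1).length_le_card.trans_eq Nat.card_eq_fintype_card.symm
    have hnl : nonloops ψ (ctxWord ψ 1 (FreeMonoid.toList v) 1) =
        nonloops ψ (ctxWord ψ 1 (FreeMonoid.toList w) 1) :=
      ((h1 _ (hlen _)).1 (List.Sublist.refl _)).antisymm ((h1 _ (hlen _)).2 (List.Sublist.refl _))
    have := mul_map_mul_eq hN hR hL (s := 1) (t := 1) (v := FreeMonoid.toList v)
      (w := FreeMonoid.toList w) (l := nonloops ψ (ctxWord ψ 1 (FreeMonoid.toList w) 1))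
      (by simpa using hnl) (by simp) (fun c => by simpa using h2 c)
    simpa using this

theorem vMem_succ_iff (n : ℕ) (M : BFinMonoid) :
    VMem (n + 1) M ↔ ∃ e, SatE e n M.carrier := by
  induction n generalizing M with
  | zero => exact jTrivial_iff_exists_satE
  | succ n ih =>
    exact ⟨fun h => h.exists_satE fun K => (ih K).1, fun ⟨_, h⟩ => h.memBlockJ fun K => (ih K).2⟩

end Main

/-- For `n ≥ 1`, a finite monoid belongs to `V_n` iff it satisfies the identities
`u_n = v_n` and `x·x^ω = x^ω`. -/
theorem Vn_iff_identities (n : ℕ) (hn : 1 ≤ n) (M : Type) [Monoid M] [Fintype M] :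
    VMem n ⟨M⟩ ↔
      ((∀ X : ℕ → M, uTerm X n = vTerm X n) ∧
        ∀ x : M, x * omegaPow x = omegaPow x) := by
  obtain ⟨n, rfl⟩ := Nat.exists_eq_add_of_le' hn
  exact (vMem_succ_iff n ⟨M⟩).trans (identities_iff_exists_satE n).symm
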